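/- Let Y be a perfect single-error-correcting code in H(D,q) (minimum distance 3, dual degree s^* = 1) containing the zero word. Then A_ℓχ_Y is a relative 2-codesign with respect to x = (0,…,0) for all ℓ; consequently |Y ∩ R_k(x) ∩ R_ℓ(z)| is independent of z at Hamming distance 2 from x, and the supports of the codewords of any fixed weight k form a 2-design on the D coordinates. -/

import Mathlib

open Matrix

noncomputable section

/-- The characteristic vector of a subset. -/
def chiv {X : Type*} [DecidableEq X] (Y : Finset X) : X → ℂ := fun y => if y ∈ Y then 1 else 0

/-- The `i`-th associate matrix of the Hamming scheme `H(D,q)`: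
`(A_i)_{x y} = 1` iff the Hamming distance of `x` and `y` is `i`. -/
def hammingA (D q : ℕ) (i : ℕ) : Matrix (Fin D → Fin q) (Fin D → Fin q) ℂ :=
  Matrix.of fun x y => if hammingDist x y = i then 1 else 0

/-- The Krawtchouk polynomial value `K_j(i) = Σ_h (-1)^h (q-1)^{j-h} C(i,h) C(D-i,j-h)`. -/
def kraw (D q : ℕ) (j i : ℕ) : ℂ :=
  ∑ h ∈ Finset.range (j + 1),
    (-1 : ℂ) ^ h * ((q : ℂ) - 1) ^ (j - h) * (Nat.choose i h : ℂ) *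
      (Nat.choose (D - i) (j - h) : ℂ)

/-- The `j`-th primitive (Krawtchouk) idempotent of the Hamming scheme `H(D,q)`:
`E_j = q^{-D} Σ_i K_j(i) A_i`. -/
def hammingE (D q : ℕ) (j : ℕ) : Matrix (Fin D → Fin q) (Fin D → Fin q) ℂ :=
  ((q : ℂ) ^ D)⁻¹ • ∑ i ∈ Finset.range (D + 1), kraw D q j i • hammingA D q i

/-- The minimum distance `δ(Y) = min { i ≠ 0 : some pair of words of Y is at distance i }`. -/
def hMinDist {D q : ℕ} (Y : Finset (Fin D → Fin q)) : ℕ :=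
  sInf {i : ℕ | i ≠ 0 ∧ ∃ u ∈ Y, ∃ v ∈ Y, hammingDist u v = i}

/-- The degree `s(Y) = #{ i ≠ 0 : some pair of words of Y is at distance i }`. -/
def hDeg {D q : ℕ} (Y : Finset (Fin D → Fin q)) : ℕ :=
  {i : ℕ | i ≠ 0 ∧ ∃ u ∈ Y, ∃ v ∈ Y, hammingDist u v = i}.ncard

/-- The set of nontrivial dual eigenvalues `{ j ≠ 0 : E_j χ_Y ≠ 0 }` of `Y`. -/
def hDualSet (D q : ℕ) (Y : Finset (Fin D → Fin q)) : Set ℕ :=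
  {j : ℕ | j ≠ 0 ∧ j ≤ D ∧ (hammingE D q j).mulVec (chiv Y) ≠ 0}

/-- The dual distance `δ^*(Y)`. -/
def hDualDist (D q : ℕ) (Y : Finset (Fin D → Fin q)) : ℕ := sInf (hDualSet D q Y)

/-- The dual degree `s^*(Y)`. -/
def hDualDeg (D q : ℕ) (Y : Finset (Fin D → Fin q)) : ℕ := (hDualSet D q Y).ncard

open Polynomial in
/-- generating function of the Krawtchouk kernel -/
def genG (D q : ℕ) (x y : Fin D → Fin q) : ℂ[X] :=
  ∏ p, (if x p = y p then 1 + C ((q : ℂ) - 1) * X else 1 - X)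

open Polynomial in
lemma coeff_one_add_C_mul_X_pow' (a : ℂ) (n k : ℕ) :
    ((1 + C a * X : ℂ[X]) ^ n).coeff k = (n.choose k : ℂ) * a ^ k := by
  have : (1 + C a * X : ℂ[X]) ^ n = ((1 + X : ℂ[X]) ^ n).comp (C a * X) := by simp
  rw [this, comp_C_mul_X_coeff, coeff_one_add_X_pow]

open Polynomial in
lemma genG_coeff (D q : ℕ) (x y : Fin D → Fin q) (j : ℕ) :
    (genG D q x y).coeff j = kraw D q j (hammingDist x y) := by
  have h1 : genG D q x y = (1 + C (-1 : ℂ) * X) ^ (hammingDist x y) *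
      (1 + C ((q : ℂ) - 1) * X) ^ (D - hammingDist x y) := by
    unfold genG
    rw [Finset.prod_ite, Finset.prod_const, Finset.prod_const, mul_comm]
    have h2 := Finset.card_filter_add_card_filter_not (s := (Finset.univ : Finset (Fin D)))
      (fun p => x p = y p)
    have h3 : (Finset.univ.filter fun p => ¬ x p = y p).card = hammingDist x y := rfl
    rw [h3] at h2 ⊢
    have h4 : (Finset.univ.filter fun p => x p = y p).card = D - hammingDist x y := by
      simp at h2; omega
    rw [h4]
    congr 2
    simp [sub_eq_add_neg]
  rw [h1, coeff_mul, Finset.Nat.sum_antidiagonal_eq_sum_range_succ_mk]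
  unfold kraw
  refine Finset.sum_congr rfl fun h _ => ?_
  simp only [coeff_one_add_C_mul_X_pow']
  ring

lemma kraw_zero (D q i : ℕ) : kraw D q 0 i = 1 := by simp [kraw]

open Polynomial in
lemma genG_natDegree (D q : ℕ) (x y : Fin D → Fin q) : (genG D q x y).natDegree ≤ D := by
  unfold genG
  refine (natDegree_prod_le _ _).trans ?_
  calc _ ≤ ∑ p : Fin D, 1 := by
        refine Finset.sum_le_sum fun p _ => ?_
        split_ifs <;> compute_degree
    _ = D := by simp

open Polynomial in
lemma genG_sum (D q : ℕ) (x y : Fin D → Fin q) :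
    ∑ j ∈ Finset.range (D + 1), kraw D q j (hammingDist x y)
      = if x = y then (q : ℂ) ^ D else 0 := by
  have h := eval_eq_sum_range' (Nat.lt_succ_of_le (genG_natDegree D q x y)) (1 : ℂ)
  simp only [one_pow, mul_one, genG_coeff] at h
  rw [Nat.succ_eq_add_one] at h
  rw [← h]
  unfold genG
  rw [eval_prod]
  split_ifs with hxy
  · subst hxy; simp
  · obtain ⟨p, hp⟩ := Function.ne_iff.mp hxy
    exact Finset.prod_eq_zero (Finset.mem_univ p) (by simp [hp])

open Polynomial in
lemma genG_nbr (D q : ℕ) (x y : Fin D → Fin q) :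
    ∑ p, ∑ c, genG D q (Function.update x p c) y
      = C ((D : ℂ) * q) * genG D q x y - C (q : ℂ) * (X * derivative (genG D q x y)) := by
  have hp : ∀ p, ∑ c, genG D q (Function.update x p c) y
      = C (q : ℂ) * ∏ i ∈ Finset.univ.erase p,
        (if x i = y i then 1 + C ((q : ℂ) - 1) * X else 1 - X) := by
    intro p
    have h1 : ∀ c, genG D q (Function.update x p c) y
        = (if c = y p then 1 + C ((q : ℂ) - 1) * X else 1 - X) * ∏ i ∈ Finset.univ.erase p,
        (if x i = y i then 1 + C ((q : ℂ) - 1) * X else 1 - X) := by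
      intro c
      unfold genG
      rw [← Finset.mul_prod_erase _ _ (Finset.mem_univ p)]
      congr 1
      · simp
      · refine Finset.prod_congr rfl fun i hi => ?_
        rw [Function.update_of_ne (Finset.ne_of_mem_erase hi)]
    simp only [h1]
    rw [← Finset.sum_mul]
    congr 1
    have h2 : ∀ c : Fin q, (if c = y p then 1 + C ((q : ℂ) - 1) * X else 1 - X : ℂ[X])
        = (if c = y p then C (q : ℂ) * X else 0) + (1 - X) := by
      intro c; split_ifs
      · simp; ring
      · simp
    simp only [h2]
    rw [Finset.sum_add_distrib]
    simp
    try ring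
  simp only [hp]
  have hd : derivative (genG D q x y) = ∑ p, (∏ i ∈ Finset.univ.erase p,
        (if x i = y i then 1 + C ((q : ℂ) - 1) * X else 1 - X)) *
        derivative (if x p = y p then 1 + C ((q : ℂ) - 1) * X else 1 - X) := by
    unfold genG; rw [derivative_prod_finset]
  have hD : C ((D : ℂ) * q) * genG D q x y = ∑ p : Fin D, C (q : ℂ) *
     ((if x p = y p then 1 + C ((q : ℂ) - 1) * X else 1 - X) * ∏ i ∈ Finset.univ.erase p,
        (if x i = y i then 1 + C ((q : ℂ) - 1) * X else 1 - X)) := by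
    have : ∀ p : Fin D, ((if x p = y p then 1 + C ((q : ℂ) - 1) * X else 1 - X) *
        ∏ i ∈ Finset.univ.erase p,
        (if x i = y i then 1 + C ((q : ℂ) - 1) * X else 1 - X)) = genG D q x y := by
      intro p
      exact Finset.mul_prod_erase Finset.univ
        (fun i => (if x i = y i then 1 + C ((q : ℂ) - 1) * X else 1 - X : ℂ[X])) (Finset.mem_univ p)
    simp only [this]
    simp
    ring
  rw [hD, hd, Finset.mul_sum, Finset.mul_sum, ← Finset.sum_sub_distrib]
  refine Finset.sum_congr rfl fun p _ => ?_
  split_ifs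
  · simp; ring
  · simp; ring

lemma kraw_nbr (D q : ℕ) (x y : Fin D → Fin q) (j : ℕ) :
    ∑ p, ∑ c, kraw D q j (hammingDist (Function.update x p c) y)
      = ((D : ℂ) * q - q * j) * kraw D q j (hammingDist x y) := by
  have h := congrArg (fun P => Polynomial.coeff P j) (genG_nbr D q x y)
  simp only [Polynomial.finsetSum_coeff, genG_coeff, Polynomial.coeff_sub,
    Polynomial.coeff_C_mul] at h
  rw [h]
  cases j with
  | zero => simp
  | succ j =>
    rw [Polynomial.coeff_X_mul, Polynomial.coeff_derivative, genG_coeff]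
    push_cast; ring

lemma hammingE_mulVec (D q j : ℕ) (Y : Finset (Fin D → Fin q)) (x : Fin D → Fin q) :
    (hammingE D q j).mulVec (chiv Y) x
      = ((q : ℂ) ^ D)⁻¹ * ∑ y ∈ Y, kraw D q j (hammingDist x y) := by
  have h1 : ∀ y, hammingE D q j x y = ((q : ℂ) ^ D)⁻¹ * kraw D q j (hammingDist x y) := by
    intro y
    have : hammingDist x y < D + 1 := by
      have := hammingDist_le_card_fintype (x := x) (y := y)
      simp at this; omega
    simp [hammingE, hammingA, Matrix.sum_apply, this]
  simp only [Matrix.mulVec, dotProduct, h1, chiv]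
  simp [Finset.mul_sum]

/-- the characteristic vector is an affine eigenvector -/
lemma chiv_nbr (D q : ℕ) (hq : 2 ≤ q) (Y : Finset (Fin D → Fin q)) (hs : hDualDeg D q Y = 1) :
    ∃ α β : ℂ, ∀ u, ∑ p, ∑ c, chiv Y (Function.update u p c) = α * chiv Y u + β := by
  obtain ⟨j, hj⟩ := Set.ncard_eq_one.mp hs
  set e : ℕ → (Fin D → Fin q) → ℂ := fun j => (hammingE D q j).mulVec (chiv Y) with he
  have hjm : j ∈ hDualSet D q Y := by rw [hj]; rfl
  obtain ⟨hj0, hjD, -⟩ := hjm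
  have hq0 : (q : ℂ) ^ D ≠ 0 := pow_ne_zero _ (by norm_cast; omega)
  have hsum : ∀ u, ∑ j ∈ Finset.range (D + 1), e j u = chiv Y u := by
    intro u
    simp only [he, hammingE_mulVec]
    rw [← Finset.mul_sum, Finset.sum_comm]
    simp only [genG_sum]
    simp [chiv, hq0]
  have hdec : ∀ u, chiv Y u = e 0 u + e j u := by
    intro u
    rw [← hsum u]
    have : ({0, j} : Finset ℕ) ⊆ Finset.range (D + 1) := by
      intro a ha; simp at ha ⊢; omega
    rw [← Finset.sum_subset this, Finset.sum_pair (Ne.symm hj0)]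
    intro a ha hna
    simp at ha hna
    by_contra hne
    have : a ∈ hDualSet D q Y := ⟨hna.1, by omega, fun h0 => hne (congrFun h0 u)⟩
    rw [hj] at this
    exact hna.2 this
  have he0 : ∀ u, e 0 u = ((q : ℂ) ^ D)⁻¹ * Y.card := by
    intro u; simp [he, hammingE_mulVec, kraw_zero]
  have hen : ∀ i u, ∑ p, ∑ c, e i (Function.update u p c) = ((D : ℂ) * q - q * i) * e i u := by
    intro i u
    simp only [he, hammingE_mulVec]
    simp only [← Finset.mul_sum]
    rw [mul_left_comm]
    congr 1
    rw [Finset.mul_sum]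
    simp only [← kraw_nbr]
    rw [Finset.sum_comm]
    rw [Finset.sum_comm]
    rw [Finset.sum_comm (s := Y)]
    refine Finset.sum_congr rfl fun p _ => ?_
    rw [Finset.sum_comm]
  refine ⟨(D : ℂ) * q - q * j, q * j * (((q : ℂ) ^ D)⁻¹ * Y.card), fun u => ?_⟩
  simp only [hdec, Finset.sum_add_distrib, hen]
  simp only [he0]
  push_cast; ring

/-- weight outside `S` -/
def outW {D q : ℕ} (S : Finset (Fin D)) (o : Fin q) (u : Fin D → Fin q) : ℕ :=
  (Finset.univ.filter fun i => i ∉ S ∧ u i ≠ o).card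

/-- class indicator -/
def clsI {D q : ℕ} (S : Finset (Fin D)) (o : Fin q) (w : ℕ) (s u : Fin D → Fin q) : ℂ :=
  if (∀ i ∈ S, u i = s i) ∧ outW S o u = w then 1 else 0

lemma nbr_adjoint {D q : ℕ} (F h : (Fin D → Fin q) → ℂ) :
    ∑ u, F u * ∑ p, ∑ c, h (Function.update u p c)
      = ∑ u, h u * ∑ p, ∑ c, F (Function.update u p c) := by
  simp only [Finset.mul_sum]
  rw [Finset.sum_comm]
  rw [Finset.sum_comm (s := Finset.univ) (t := Finset.univ)
    (f := fun u p => ∑ c, h u * F (Function.update u p c))]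
  refine Finset.sum_congr rfl fun p _ => ?_
  rw [← Finset.sum_product', ← Finset.sum_product']
  refine Finset.sum_nbij' (fun a => (Function.update a.1 p a.2, a.1 p))
    (fun a => (Function.update a.1 p a.2, a.1 p)) ?_ ?_ ?_ ?_ ?_
  · simp
  · simp
  · simp
  · simp
  · rintro ⟨u, c⟩ _; simp [mul_comm]

lemma outW_update_mem {D q : ℕ} (S : Finset (Fin D)) (o : Fin q) (u : Fin D → Fin q)
    (p : Fin D) (hp : p ∈ S) (c : Fin q) : outW S o (Function.update u p c) = outW S o u := by
  unfold outW
  congr 1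
  ext i
  by_cases h : i = p
  · subst h; simp [hp]
  · simp [Function.update_of_ne h]

lemma outW_update {D q : ℕ} (S : Finset (Fin D)) (o : Fin q) (u : Fin D → Fin q)
    (p : Fin D) (hp : p ∉ S) (c : Fin q) :
    outW S o (Function.update u p c) + (if u p = o then 0 else 1)
      = outW S o u + (if c = o then 0 else 1) := by
  have key : ∀ v : Fin D → Fin q, outW S o v
      = (if v p = o then 0 else 1) +
        ∑ i ∈ Finset.univ.erase p, (if i ∉ S ∧ v i ≠ o then 1 else 0) := by
    intro v
    unfold outW
    rw [Finset.card_filter, ← Finset.add_sum_erase _ _ (Finset.mem_univ p)]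
    congr 1
    by_cases h : v p = o <;> simp [h, hp]
  rw [key, key u]
  have : ∑ i ∈ Finset.univ.erase p, (if i ∉ S ∧ Function.update u p c i ≠ o then 1 else 0)
      = ∑ i ∈ Finset.univ.erase p, (if i ∉ S ∧ u i ≠ o then 1 else 0) := by
    refine Finset.sum_congr rfl fun i hi => ?_
    rw [Function.update_of_ne (Finset.ne_of_mem_erase hi)]
  rw [this]
  simp
  ring

lemma clsI_nbr_mem {D q : ℕ} (S : Finset (Fin D)) (o : Fin q) (w : ℕ) (s u : Fin D → Fin q)
    (p : Fin D) (hp : p ∈ S) :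
    ∑ c, clsI S o w s (Function.update u p c) = ∑ c, clsI S o w (Function.update s p c) u := by
  have h1 : ∀ c, clsI S o w s (Function.update u p c) = if c = s p then
      (if (∀ i ∈ S, i ≠ p → u i = s i) ∧ outW S o u = w then 1 else 0) else 0 := by
    intro c
    unfold clsI
    rw [outW_update_mem S o u p hp, ← ite_and]
    congr 1
    apply propext
    constructor
    · rintro ⟨h, h'⟩
      refine ⟨by simpa using h p hp, fun i hi hne => ?_, h'⟩
      simpa [hne] using h i hi
    · rintro ⟨h, h2, h'⟩
      refine ⟨fun i hi => ?_, h'⟩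
      by_cases hne : i = p
      · subst hne; simpa using h
      · simpa [hne] using h2 i hi hne
  have h2 : ∀ c, clsI S o w (Function.update s p c) u = if c = u p then
      (if (∀ i ∈ S, i ≠ p → u i = s i) ∧ outW S o u = w then 1 else 0) else 0 := by
    intro c
    unfold clsI
    rw [← ite_and]
    congr 1
    apply propext
    constructor
    · rintro ⟨h, h'⟩
      refine ⟨by simpa using (h p hp).symm, fun i hi hne => ?_, h'⟩
      simpa [hne] using h i hi
    · rintro ⟨h, h2, h'⟩
      refine ⟨fun i hi => ?_, h'⟩
      by_cases hne : i = p
      · subst hne; simpa using h.symm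
      · simpa [hne] using h2 i hi hne
  simp [h1, h2]

lemma clsI_nbr_not_mem {D q : ℕ} (S : Finset (Fin D)) (o : Fin q) (w : ℕ) (s u : Fin D → Fin q)
    (p : Fin D) (hp : p ∉ S) :
    ∑ c, clsI S o w s (Function.update u p c) =
      if u p = o then clsI S o w s u + ((q : ℂ) - 1) * (if w = 0 then 0 else clsI S o (w - 1) s u)
      else clsI S o (w + 1) s u + ((q : ℂ) - 1) * clsI S o w s u := by
  have hS : ∀ c, (∀ i ∈ S, Function.update u p c i = s i) ↔ ∀ i ∈ S, u i = s i := by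
    intro c
    refine forall₂_congr fun i hi => ?_
    rw [Function.update_of_ne (by rintro rfl; exact hp hi)]
  have hcard : ((Finset.univ.erase o : Finset (Fin q)).card : ℂ) = (q : ℂ) - 1 := by
    have : 1 ≤ q := by have := o.2; omega
    rw [Finset.card_erase_of_mem (Finset.mem_univ o)]
    simp [Nat.cast_sub this]
  rw [← Finset.add_sum_erase _ _ (Finset.mem_univ o)]
  have hW := outW_update S o u p hp
  split_ifs with h0 hw
  · subst hw
    have : ∀ c ∈ Finset.univ.erase o, clsI S o 0 s (Function.update u p c) = 0 := by
      intro c hc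
      have := hW c
      rw [if_pos h0, if_neg (Finset.ne_of_mem_erase hc)] at this
      unfold clsI
      rw [if_neg]; rintro ⟨-, h⟩; omega
    rw [Finset.sum_eq_zero this]
    have := hW o
    rw [if_pos h0, if_pos rfl] at this
    simp only [add_zero] at this
    unfold clsI
    simp only [hS, this]
    simp
  · have : ∀ c ∈ Finset.univ.erase o, clsI S o w s (Function.update u p c)
        = clsI S o (w - 1) s u := by
      intro c hc
      have := hW c
      rw [if_pos h0, if_neg (Finset.ne_of_mem_erase hc)] at this
      unfold clsI
      simp only [hS]
      have h3 : outW S o (Function.update u p c) = w ↔ outW S o u = w - 1 := by omega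
      simp only [h3]
    rw [Finset.sum_congr rfl this, Finset.sum_const, nsmul_eq_mul, hcard]
    have := hW o
    rw [if_pos h0, if_pos rfl] at this
    simp only [add_zero] at this
    congr 1
    unfold clsI
    simp only [hS, this]
  · have : ∀ c ∈ Finset.univ.erase o, clsI S o w s (Function.update u p c)
        = clsI S o w s u := by
      intro c hc
      have := hW c
      rw [if_neg h0, if_neg (Finset.ne_of_mem_erase hc)] at this
      unfold clsI
      simp only [hS]
      have h3 : outW S o (Function.update u p c) = w ↔ outW S o u = w := by omega
      simp only [h3]
    rw [Finset.sum_congr rfl this, Finset.sum_const, nsmul_eq_mul, hcard]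
    have := hW o
    rw [if_neg h0, if_pos rfl] at this
    congr 1
    unfold clsI
    simp only [hS]
    have h3 : outW S o (Function.update u p o) = w ↔ outW S o u = w + 1 := by omega
    simp only [h3]

lemma clsI_nbr {D q : ℕ} (S : Finset (Fin D)) (o : Fin q) (w : ℕ) (s u : Fin D → Fin q) :
    ∑ p, ∑ c, clsI S o w s (Function.update u p c) =
      (∑ p ∈ S, ∑ c, clsI S o w (Function.update s p c) u)
      + ((w : ℂ) + 1) * clsI S o (w + 1) s u
      + ((Sᶜ.card : ℂ) - w + w * ((q : ℂ) - 1)) * clsI S o w s u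
      + ((Sᶜ.card : ℂ) - w + 1) * ((q : ℂ) - 1) * (if w = 0 then 0 else clsI S o (w - 1) s u) := by
  rw [← Finset.sum_add_sum_compl S, Finset.sum_congr rfl fun p hp => clsI_nbr_mem S o w s u p hp]
  rw [Finset.sum_congr rfl fun p hp => clsI_nbr_not_mem S o w s u p (Finset.mem_compl.mp hp)]
  rw [add_assoc, add_assoc]
  congr 1
  rw [Finset.sum_ite, Finset.sum_const, Finset.sum_const, nsmul_eq_mul, nsmul_eq_mul]
  have h1 : (Sᶜ.filter fun p => ¬ u p = o).card = outW S o u := by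
    unfold outW; congr 1; ext i; simp
  have h2 : ((Sᶜ.filter fun p => u p = o).card : ℂ) = (Sᶜ.card : ℂ) - outW S o u := by
    have := Finset.card_filter_add_card_filter_not (s := Sᶜ) (fun p => u p = o)
    rw [h1] at this
    rw [← this]; push_cast; ring
  rw [h1, h2]
  have hc : ∀ w', (outW S o u : ℂ) * clsI S o w' s u = (w' : ℂ) * clsI S o w' s u := by
    intro w'
    unfold clsI
    split_ifs with h
    · rw [h.2]
    · simp
  rcases w with _ | w
  · have a := hc 0
    have b := hc 1
    simp only [if_true]
    push_cast at a b ⊢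
    linear_combination b - a + ((q : ℂ) - 1) * a
  · have a := hc w
    have b := hc (w + 1)
    have c := hc (w + 1 + 1)
    simp only [Nat.add_eq_zero_iff, one_ne_zero, and_false, if_false, Nat.add_sub_cancel]
    push_cast at a b c ⊢
    linear_combination c - b + ((q : ℂ) - 1) * b - ((q : ℂ) - 1) * a

lemma cls_sum_zero {D q : ℕ} (S : Finset (Fin D)) (o : Fin q) (h : (Fin D → Fin q) → ℂ) (κ : ℂ)
    (hN : ∀ u, ∑ p, ∑ c, h (Function.update u p c) = κ * h u)
    (h0 : ∀ u, (∀ i, i ∉ S → u i = o) → h u = 0) (w : ℕ) :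
    ∀ s, ∑ u, h u * clsI S o w s u = 0 := by
  induction w using Nat.strong_induction_on with
  | _ w ih =>
    intro s
    rcases w with _ | w
    · refine Finset.sum_eq_zero fun u _ => ?_
      unfold clsI
      split_ifs with hu
      · rw [h0 u, zero_mul]
        intro i hi
        by_contra hne
        have := hu.2
        unfold outW at this
        rw [Finset.card_eq_zero, Finset.filter_eq_empty_iff] at this
        exact this (Finset.mem_univ i) ⟨hi, hne⟩
      · simp
    · have hA := nbr_adjoint (clsI S o w s) h
      simp only [hN, clsI_nbr] at hA
      have hL : ∑ u, clsI S o w s u * (κ * h u) = 0 := by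
        have := ih w (by omega) s
        rw [← mul_zero κ, ← this, Finset.mul_sum]
        exact Finset.sum_congr rfl fun u _ => by ring
      rw [hL] at hA
      simp only [mul_add, Finset.sum_add_distrib] at hA
      have e1 : ∑ u, h u * ∑ p ∈ S, ∑ c, clsI S o w (Function.update s p c) u = 0 := by
        simp only [Finset.mul_sum]
        rw [Finset.sum_comm]
        refine Finset.sum_eq_zero fun p _ => ?_
        rw [Finset.sum_comm]
        exact Finset.sum_eq_zero fun c _ => ih w (by omega) _
      have e2 : ∀ (a : ℂ) (g : (Fin D → Fin q) → ℂ), ∑ u, h u * (a * g u)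
          = a * ∑ u, h u * g u := by
        intro a g
        rw [Finset.mul_sum]
        exact Finset.sum_congr rfl fun u _ => by ring
      have e4 : ∑ u, h u * (if w = 0 then 0 else clsI S o (w - 1) s u) = 0 := by
        split_ifs with hw
        · simp
        · exact ih (w - 1) (by omega) s
      rw [e1, e2, e2 _ (fun u => if w = 0 then 0 else clsI S o (w - 1) s u), e4] at hA
      simp only [← mul_add, e2, ih w (by omega) s] at hA
      have hw : (w : ℂ) + 1 ≠ 0 := by exact_mod_cast Nat.succ_ne_zero w
      simp only [mul_zero, zero_add, add_zero] at hA
      exact (mul_eq_zero.mp hA.symm).resolve_left hw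

lemma pred_sum_zero {D q : ℕ} (S : Finset (Fin D)) (o : Fin q) (h : (Fin D → Fin q) → ℂ) (κ : ℂ)
    (hN : ∀ u, ∑ p, ∑ c, h (Function.update u p c) = κ * h u)
    (h0 : ∀ u, (∀ i, i ∉ S → u i = o) → h u = 0)
    (Q : (Fin D → Fin q) → Prop) [DecidablePred Q]
    (hQ : ∀ u v, (∀ i ∈ S, u i = v i) → outW S o u = outW S o v → (Q u ↔ Q v)) :
    ∑ u, (if Q u then h u else 0) = 0 := by
  set g : (Fin D → Fin q) → (Fin D → Fin q) × ℕ :=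
    fun u => (fun i => if i ∈ S then u i else o, outW S o u) with hg
  have hgi : ∀ u v, g u = g v ↔ (∀ i ∈ S, u i = v i) ∧ outW S o u = outW S o v := by
    intro u v
    simp only [hg, Prod.mk.injEq]
    refine and_congr_left fun _ => ⟨fun h i hi => ?_, fun h => ?_⟩
    · simpa [hi] using congrFun h i
    · funext i
      split_ifs with hi
      · exact h i hi
      · rfl
  rw [← Finset.sum_fiberwise_of_maps_to (t := Finset.univ.image g) (g := g)
    (fun u hu => Finset.mem_image_of_mem g hu)]
  refine Finset.sum_eq_zero fun t ht => ?_
  obtain ⟨v, -, rfl⟩ := Finset.mem_image.mp ht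
  have := cls_sum_zero S o h κ hN h0 (outW S o v) v
  rw [Finset.sum_filter]
  by_cases hv : Q v
  · refine Eq.trans ?_ this
    refine Finset.sum_congr rfl fun u _ => ?_
    unfold clsI
    rw [← ite_and]
    simp only [hgi u v, mul_ite, mul_one, mul_zero]
    refine if_congr ⟨fun h => h.1, fun h => ⟨h, (hQ u v h.1 h.2).mpr hv⟩⟩ rfl rfl
  · refine Finset.sum_eq_zero fun u _ => ?_
    rw [← ite_and, if_neg]
    rintro ⟨h1, h2⟩
    rw [hgi] at h1
    exact hv ((hQ u v h1.1 h1.2).mp h2)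

/-- isometry -/
def isoE {D q : ℕ} (π : Equiv.Perm (Fin D)) (σ : Fin D → Equiv.Perm (Fin q)) :
    (Fin D → Fin q) ≃ (Fin D → Fin q) where
  toFun u i := σ i (u (π i))
  invFun u i := (σ (π.symm i)).symm (u (π.symm i))
  left_inv u := by funext i; simp
  right_inv u := by funext i; simp

lemma isoE_update {D q : ℕ} (π : Equiv.Perm (Fin D)) (σ : Fin D → Equiv.Perm (Fin q))
    (u : Fin D → Fin q) (p : Fin D) (c : Fin q) :
    isoE π σ (Function.update u (π p) c) = Function.update (isoE π σ u) p (σ p c) := by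
  funext i
  by_cases h : i = p
  · subst h; simp [isoE]
  · simp [isoE, h]

lemma isoE_dist {D q : ℕ} (π : Equiv.Perm (Fin D)) (σ : Fin D → Equiv.Perm (Fin q))
    (u v : Fin D → Fin q) : hammingDist (isoE π σ u) (isoE π σ v) = hammingDist u v := by
  unfold hammingDist isoE
  refine Finset.card_equiv π ?_
  intro i; simp

lemma isoE_nbr {D q : ℕ} (π : Equiv.Perm (Fin D)) (σ : Fin D → Equiv.Perm (Fin q))
    (f : (Fin D → Fin q) → ℂ) (u : Fin D → Fin q) :
    ∑ p, ∑ c, f (isoE π σ (Function.update u p c))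
      = ∑ p, ∑ c, f (Function.update (isoE π σ u) p c) := by
  rw [← Equiv.sum_comp π]
  refine Finset.sum_congr rfl fun p _ => ?_
  simp only [isoE_update]
  exact Equiv.sum_comp (σ p) (fun c => f (Function.update (isoE π σ u) p c))

lemma transfer {D q : ℕ} (Y : Finset (Fin D → Fin q)) (o : Fin q) (α β : ℂ)
    (hN : ∀ u, ∑ p, ∑ c, chiv Y (Function.update u p c) = α * chiv Y u + β)
    (hoY : (fun _ => o) ∈ Y) (hmin : ∀ u ∈ Y, ∀ v ∈ Y, u ≠ v → 3 ≤ hammingDist u v)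
    (z z' : Fin D → Fin q) (hz : hammingDist (fun _ => o) z ≤ 2)
    (hzz : hammingDist (fun _ => o) z = hammingDist (fun _ => o) z') :
    ∃ ψ : (Fin D → Fin q) ≃ (Fin D → Fin q), ψ z = z' ∧ ψ (fun _ => o) = (fun _ => o) ∧
      (∀ u v, hammingDist (ψ u) (ψ v) = hammingDist u v) ∧
      (∃ π : Equiv.Perm (Fin D), ∀ u i, ψ u i = o ↔ u (π i) = o) ∧
      ∀ (Q Q' : (Fin D → Fin q) → Prop) [DecidablePred Q] [DecidablePred Q'],
      (∀ u v, (∀ i, z i ≠ o → u i = v i) →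
        outW (Finset.univ.filter fun i => z i ≠ o) o u
          = outW (Finset.univ.filter fun i => z i ≠ o) o v → (Q u ↔ Q v)) →
      (∀ u, Q u ↔ Q' (ψ u)) → (Y.filter Q).card = (Y.filter Q').card := by
  have hsupp : ∀ z : Fin D → Fin q, hammingDist (fun _ => o) z
      = (Finset.univ.filter fun i => z i ≠ o).card := by
    intro z; unfold hammingDist; congr 1; ext i; simp [eq_comm]
  have hcard : Fintype.card {i // z' i ≠ o} = Fintype.card {i // z i ≠ o} := by
    rw [Fintype.card_subtype, Fintype.card_subtype, ← hsupp, ← hsupp, hzz]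
  set π : Equiv.Perm (Fin D) := (Fintype.equivOfCardEq hcard).extendSubtype with hπ
  have hπz : ∀ i, z (π i) = o ↔ z' i = o := by
    intro i
    constructor
    · intro h; by_contra hne
      exact (Fintype.equivOfCardEq hcard).extendSubtype_mem i hne h
    · intro h; by_contra hne
      exact (Fintype.equivOfCardEq hcard).extendSubtype_not_mem i (not_not.mpr h) hne
  set σ : Fin D → Equiv.Perm (Fin q) := fun i => Equiv.swap (z (π i)) (z' i) with hσ
  have hσo : ∀ i, σ i o = o := by
    intro i
    by_cases h : z' i = o
    · have := (hπz i).mpr h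
      simp [hσ, this, h]
    · have : z (π i) ≠ o := fun h' => h ((hπz i).mp h')
      exact Equiv.swap_apply_of_ne_of_ne this.symm (Ne.symm h)
  have hψo : isoE π σ (fun _ => o) = (fun _ => o) := by
    funext i; exact hσo i
  refine ⟨isoE π σ, ?_, hψo, isoE_dist π σ, ⟨π, fun u i => ?_⟩, ?_⟩
  · funext i; simp [isoE, hσ]
  · constructor
    · intro h
      exact (σ i).injective (h.trans (hσo i).symm)
    · intro h
      show σ i (u (π i)) = o
      rw [h, hσo]
  intro Q Q' _ _ hQ hQQ
  have hsm : ∀ u, (∀ i, i ∉ (Finset.univ.filter fun i => z i ≠ o) → u i = o) →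
      hammingDist (fun _ => o) u ≤ 2 := by
    intro u hu
    refine le_trans ?_ hz
    rw [hsupp, hsupp]
    apply Finset.card_le_card
    intro i hi
    by_contra hne
    simp only [Finset.mem_filter] at hi
    exact hi.2 (hu i hne)
  have hval : ∀ u, hammingDist (fun _ => o) u ≤ 2 →
      chiv Y u = if u = (fun _ => o) then 1 else 0 := by
    intro u hu
    unfold chiv
    refine if_congr ⟨fun h => ?_, fun h => h ▸ hoY⟩ rfl rfl
    by_contra hne
    have := hmin _ hoY u h (Ne.symm hne)
    omega
  have key := pred_sum_zero (Finset.univ.filter fun i => z i ≠ o) o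
    (fun u => chiv Y u - chiv Y (isoE π σ u)) α ?_ ?_ Q ?_
  · have h1 : ∑ u, (if Q u then chiv Y u else 0) = ((Y.filter Q).card : ℂ) := by
      rw [Finset.card_filter]
      push_cast
      simp only [chiv, ← ite_and]
      rw [← Finset.sum_filter, ← Finset.sum_filter]
      congr 1
      ext u; simp [and_comm]
    have h2 : ∑ u, (if Q u then chiv Y (isoE π σ u) else 0) = ((Y.filter Q').card : ℂ) := by
      simp only [hQQ]
      rw [Equiv.sum_comp (isoE π σ) (fun u => if Q' u then chiv Y u else 0)]
      rw [Finset.card_filter]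
      push_cast
      simp only [chiv, ← ite_and]
      rw [← Finset.sum_filter, ← Finset.sum_filter]
      congr 1
      ext u; simp [and_comm]
    have h3 : ((Y.filter Q).card : ℂ) - ((Y.filter Q').card : ℂ) = 0 := by
      rw [← h1, ← h2, ← Finset.sum_sub_distrib, ← key]
      refine Finset.sum_congr rfl fun u _ => ?_
      split_ifs <;> simp
    exact_mod_cast sub_eq_zero.mp h3
  · intro u
    simp only [Finset.sum_sub_distrib]
    rw [isoE_nbr, hN, hN]
    ring
  · intro u hu
    have h1 := hsm u hu
    have h2 : hammingDist (fun _ => o) (isoE π σ u) ≤ 2 := by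
      rw [← hψo, isoE_dist]; exact h1
    simp only [hval u h1, hval _ h2]
    have : isoE π σ u = (fun _ => o) ↔ u = fun _ => o := by
      conv_lhs => rw [← hψo]
      exact (isoE π σ).apply_eq_iff_eq
    simp [this]
  · intro u v huv
    exact hQ u v (fun i hi => huv i (by simpa using hi))

lemma dist_outW {D q : ℕ} (o : Fin q) (z a : Fin D → Fin q) (ha : ∀ i, z i = o → a i = o)
    (u v : Fin D → Fin q) (huv : ∀ i, z i ≠ o → u i = v i)
    (hw : outW (Finset.univ.filter fun i => z i ≠ o) o u
          = outW (Finset.univ.filter fun i => z i ≠ o) o v) :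
    hammingDist a u = hammingDist a v := by
  have key : ∀ u : Fin D → Fin q, hammingDist a u
      = (Finset.univ.filter fun i => z i ≠ o ∧ a i ≠ u i).card
        + outW (Finset.univ.filter fun i => z i ≠ o) o u := by
    intro u
    unfold hammingDist outW
    rw [← Finset.card_filter_add_card_filter_not (fun i => z i ≠ o), Finset.filter_filter,
      Finset.filter_filter]
    congr 2
    · ext i; simp [and_comm]
    · ext i
      simp only [Finset.mem_filter, Finset.mem_univ, true_and, not_not]
      constructor
      · rintro ⟨h1, h2⟩
        exact ⟨h2, fun h => h1 (by rw [ha i h2, h])⟩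
      · rintro ⟨h1, h2⟩
        exact ⟨fun h => h2 (by rw [← h, ha i h1]), h1⟩
  rw [key, key v, hw]
  congr 2
  ext i
  simp only [Finset.mem_filter, Finset.mem_univ, true_and]
  refine and_congr_right fun h => ?_
  rw [huv i h]

/-- Let `Y` be a perfect single-error-correcting code in `H(D,q)`
(minimum distance `3`, dual degree `s^* = 1`) containing the zero word `x`.  Then
`A_ℓ χ_Y` is a relative `2`-codesign with respect to `x` for all `ℓ`; consequently
`|Y ∩ R_k(x) ∩ R_ℓ(z)|` is independent of `z` at Hamming distance `2` from `x`, and the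
supports of the codewords of any fixed weight `k` form a `2`-design on the coordinates. -/
theorem perfect_code_two_design
    (D q : ℕ) (hq : 2 ≤ q) (Y : Finset (Fin D → Fin q))
    (x : Fin D → Fin q) (hx0 : x = fun _ => ⟨0, by omega⟩) (hxY : x ∈ Y)
    (hδ : hMinDist Y = 3) (hs : hDualDeg D q Y = 1) :
    (∀ l : ℕ, l ≤ D → ∀ i : ℕ, 1 ≤ i → i ≤ 2 → ∃ c : ℂ,
      (Matrix.diagonal fun y => hammingA D q i x y).mulVec
          ((hammingA D q l).mulVec (chiv Y))
        = c • (hammingA D q i).mulVec (Pi.single x 1)) ∧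
    (∀ k l : ℕ, k ≤ D → l ≤ D → ∀ z z' : Fin D → Fin q,
      hammingDist x z = 2 → hammingDist x z' = 2 →
      {y ∈ Y | hammingDist x y = k ∧ hammingDist z y = l}.card
        = {y ∈ Y | hammingDist x y = k ∧ hammingDist z' y = l}.card) ∧
    (∀ k : ℕ, k ≤ D → ∃ lam : ℕ, ∀ p₁ p₂ : Fin D, p₁ ≠ p₂ →
      {y ∈ Y | hammingDist x y = k ∧ y p₁ ≠ x p₁ ∧ y p₂ ≠ x p₂}.card = lam) := by
  set o : Fin q := ⟨0, by omega⟩ with ho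
  subst hx0
  obtain ⟨α, β, hN⟩ := chiv_nbr D q hq Y hs
  have hmin : ∀ u ∈ Y, ∀ v ∈ Y, u ≠ v → 3 ≤ hammingDist u v := by
    intro u hu v hv hne
    rw [← hδ]
    exact Nat.sInf_le ⟨hammingDist_ne_zero.mpr hne, u, hu, v, hv, rfl⟩
  have T := transfer Y o α β hN hxY hmin
  refine ⟨?_, ?_, ?_⟩
  · intro l _ i _ hi2
    have hval : ∀ z, (hammingA D q l).mulVec (chiv Y) z
        = ((Y.filter fun y => hammingDist z y = l).card : ℂ) := by
      intro z
      simp only [Matrix.mulVec, dotProduct, hammingA, Matrix.of_apply, chiv]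
      rw [Finset.card_filter]
      simp
    have hR : ∀ z, (hammingA D q i).mulVec (Pi.single (fun _ => o) 1) z
        = if hammingDist (fun _ => o) z = i then 1 else 0 := by
      intro z
      simp [hammingA, hammingDist_comm]
    have hconst : ∀ z z', hammingDist (fun _ => o) z = i → hammingDist (fun _ => o) z' = i →
        (hammingA D q l).mulVec (chiv Y) z = (hammingA D q l).mulVec (chiv Y) z' := by
      intro z z' hz hz'
      rw [hval, hval]
      obtain ⟨ψ, h1, -, h3, -, h5⟩ := T z z' (by omega) (by omega)
      congr 1
      refine h5 _ _ (fun u v huv hw => ?_) (fun u => ?_)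
      · rw [dist_outW o z z (fun _ h => h) u v huv hw]
      · rw [← h1, h3]
    by_cases hex : ∃ z0 : Fin D → Fin q, hammingDist (fun _ => o) z0 = i
    · obtain ⟨z0, hz0⟩ := hex
      refine ⟨(hammingA D q l).mulVec (chiv Y) z0, ?_⟩
      funext z
      rw [Matrix.mulVec_diagonal, Pi.smul_apply, hR, smul_eq_mul]
      simp only [hammingA, Matrix.of_apply]
      by_cases hz : hammingDist (fun _ => o) z = i
      · rw [if_pos hz, one_mul, mul_one]
        exact hconst z z0 hz hz0
      · rw [if_neg hz, zero_mul, mul_zero]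
    · refine ⟨0, ?_⟩
      funext z
      rw [Matrix.mulVec_diagonal, Pi.smul_apply, hR, smul_eq_mul]
      simp only [hammingA, Matrix.of_apply]
      rw [if_neg (fun h => hex ⟨z, h⟩)]
      simp
  · intro k l _ _ z z' hz hz'
    obtain ⟨ψ, h1, h2, h3, -, h5⟩ := T z z' (by omega) (by omega)
    refine h5 _ _ (fun u v huv hw => ?_) (fun u => ?_)
    · rw [dist_outW o z z (fun _ h => h) u v huv hw,
        dist_outW o z (fun _ => o) (fun _ _ => rfl) u v huv hw]
    · conv_rhs => rw [← h1, ← h2]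
      rw [h3, h3]
  · intro k _
    set e : Fin q := ⟨1, by omega⟩ with he
    have heo : e ≠ o := by simp [he, ho]
    set Z : Fin D → Fin D → (Fin D → Fin q) := fun p₁ p₂ i => if i = p₁ ∨ i = p₂ then e else o
      with hZ
    have hZo : ∀ p₁ p₂ i, Z p₁ p₂ i ≠ o ↔ (i = p₁ ∨ i = p₂) := by
      intro p₁ p₂ i
      simp only [hZ]
      split_ifs with h <;> simp [h, heo]
    have hZc : ∀ p₁ p₂, p₁ ≠ p₂ → hammingDist (fun _ => o) (Z p₁ p₂) = 2 := by
      intro p₁ p₂ h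
      unfold hammingDist
      rw [← Finset.card_pair h]
      congr 1
      ext i
      simp only [Finset.mem_filter, Finset.mem_univ, true_and, Finset.mem_insert,
        Finset.mem_singleton]
      rw [← hZo, ne_comm]
    have main : ∀ p₁ p₂ p₁' p₂' : Fin D, p₁ ≠ p₂ → p₁' ≠ p₂' →
        {y ∈ Y | hammingDist (fun _ => o) y = k ∧ y p₁ ≠ o ∧ y p₂ ≠ o}.card
        = {y ∈ Y | hammingDist (fun _ => o) y = k ∧ y p₁' ≠ o ∧ y p₂' ≠ o}.card := by
      intro p₁ p₂ p₁' p₂' hp hp'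
      obtain ⟨ψ, h1, h2, h3, ⟨π, h4⟩, h5⟩ := T (Z p₁ p₂) (Z p₁' p₂') (hZc _ _ hp).le
        ((hZc _ _ hp).trans (hZc _ _ hp').symm)
      refine h5 _ _ (fun u v huv hw => ?_) (fun u => ?_)
      · rw [dist_outW o (Z p₁ p₂) (fun _ => o) (fun _ _ => rfl) u v huv hw,
          huv p₁ ((hZo _ _ _).mpr (Or.inl rfl)), huv p₂ ((hZo _ _ _).mpr (Or.inr rfl))]
      · have hd : hammingDist (fun _ => o) (ψ u) = hammingDist (fun _ => o) u := by
          conv_lhs => rw [← h2]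
          rw [h3]
        rw [hd]
        refine and_congr_right fun _ => ?_
        have hm : ∀ i, (i = p₁' ∨ i = p₂') ↔ (π i = p₁ ∨ π i = p₂) := by
          intro i
          rw [← hZo, ← hZo, ← h1]
          exact not_congr (h4 _ i)
        rw [Ne, Ne, Ne, Ne, h4 u p₁', h4 u p₂']
        have m1 := (hm p₁').mp (Or.inl rfl)
        have m2 := (hm p₂').mp (Or.inr rfl)
        have hne : π p₁' ≠ π p₂' := fun h => hp' (π.injective h)
        rcases m1 with m1 | m1 <;> rcases m2 with m2 | m2
        · exact absurd (m1.trans m2.symm) hne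
        · rw [m1, m2]
        · rw [m1, m2, and_comm]
        · exact absurd (m1.trans m2.symm) hne
    by_cases hex : ∃ a b : Fin D, a ≠ b
    · obtain ⟨a, b, hab⟩ := hex
      exact ⟨_, fun p₁ p₂ hp => main p₁ p₂ a b hp hab⟩
    · exact ⟨0, fun p₁ p₂ hp => absurd ⟨p₁, p₂, hp⟩ hex⟩
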